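/- For every real θ ≠ 0 and all x, y ∈ G, the complex conjugate of K_θ(y⁻¹·x, y⁻¹) equals K_θ(x, y), where y⁻¹ and y⁻¹·x are computed with the group law of G. -/

import Mathlib

/-- The standard symplectic form `ω₀` on `ℝ^{2d}`. -/
def omega0 (d : ℕ) (v v' : Fin (2 * d) → ℝ) : ℝ :=
  ∑ i : Fin d,
    (v ⟨(i : ℕ), by omega⟩ * v' ⟨(i : ℕ) + d, by omega⟩ -
      v ⟨(i : ℕ) + d, by omega⟩ * v' ⟨(i : ℕ), by omega⟩)

/-- The group operation on `G = ℝ × ℝ^{2d} × ℝ`: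
`(a,v,t)·(a',v',t') = (a+a', e^{−a'}v + v', e^{−2a'}t + t' + (1/2)e^{−a'}ω₀(v,v'))`. -/
noncomputable def gmul (d : ℕ) (x y : ℝ × (Fin (2 * d) → ℝ) × ℝ) :
    ℝ × (Fin (2 * d) → ℝ) × ℝ :=
  (x.1 + y.1,
    fun i => Real.exp (-y.1) * x.2.1 i + y.2.1 i,
    Real.exp (-2 * y.1) * x.2.2 + y.2.2 + (1 / 2) * Real.exp (-y.1) * omega0 d x.2.1 y.2.1)

/-- The inverse `(a,v,t)⁻¹ = (−a, −e^{a}v, −e^{2a}t)` in `G`. -/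
noncomputable def ginv (d : ℕ) (x : ℝ × (Fin (2 * d) → ℝ) × ℝ) :
    ℝ × (Fin (2 * d) → ℝ) × ℝ :=
  (-x.1, fun i => -(Real.exp x.1 * x.2.1 i), -(Real.exp (2 * x.1) * x.2.2))

/-- `A((a,v,t),(a',v',t')) =
(cosh a · cosh a' · cosh(a−a'))^d · (cosh 2a · cosh 2a' · cosh(2a−2a'))^{1/2}`. -/
noncomputable def Afun (d : ℕ) (x y : ℝ × (Fin (2 * d) → ℝ) × ℝ) : ℝ :=
  (Real.cosh x.1 * Real.cosh y.1 * Real.cosh (x.1 - y.1)) ^ d *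
    Real.sqrt (Real.cosh (2 * x.1) * Real.cosh (2 * y.1) * Real.cosh (2 * x.1 - 2 * y.1))

/-- `S((a,v,t),(a',v',t')) = sinh(2a)·t' − sinh(2a')·t + cosh(a)·cosh(a')·ω₀(v,v')`. -/
noncomputable def Sfun (d : ℕ) (x y : ℝ × (Fin (2 * d) → ℝ) × ℝ) : ℝ :=
  Real.sinh (2 * x.1) * y.2.2 - Real.sinh (2 * y.1) * x.2.2 +
    Real.cosh x.1 * Real.cosh y.1 * omega0 d x.2.1 y.2.1

/-- The Bieliavsky–Gayral kernel `K_θ(x,y) = (4/(πθ)^{2d+2})·A(x,y)·exp((2i/θ)·S(x,y))`. -/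
noncomputable def Kker (d : ℕ) (θ : ℝ) (x y : ℝ × (Fin (2 * d) → ℝ) × ℝ) : ℂ :=
  (((4 / (Real.pi * θ) ^ (2 * d + 2)) * Afun d x y : ℝ) : ℂ) *
    Complex.exp (2 * Complex.I / (θ : ℂ) * ((Sfun d x y : ℝ) : ℂ))

theorem omega0_swap (d : ℕ) (v w : Fin (2 * d) → ℝ) : omega0 d w v = -omega0 d v w := by
  simp only [omega0, ← Finset.sum_neg_distrib]
  exact Finset.sum_congr rfl fun i _ => by ring

theorem omega0_smul_left (d : ℕ) (c : ℝ) (v w : Fin (2 * d) → ℝ) :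
    omega0 d (fun i => -(c * v i)) w = -c * omega0 d v w := by
  simp only [omega0, Finset.mul_sum]
  exact Finset.sum_congr rfl fun i _ => by ring

theorem omega0_add_smul_smul (d : ℕ) (c e : ℝ) (v w : Fin (2 * d) → ℝ) :
    omega0 d (fun i => c * -(e * w i) + v i) (fun i => -(e * w i)) = -e * omega0 d v w := by
  simp only [omega0, Finset.mul_sum]
  exact Finset.sum_congr rfl fun i _ => by ring

theorem Afun_gmul_ginv (d : ℕ) (x y : ℝ × (Fin (2 * d) → ℝ) × ℝ) :
    Afun d (gmul d (ginv d y) x) (ginv d y) = Afun d x y := by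
  obtain ⟨a, v, t⟩ := x
  obtain ⟨b, w, s⟩ := y
  simp only [Afun, gmul, ginv]
  have h₁ : -b + a - -b = a := by ring
  have h₂ : 2 * (-b + a) - 2 * -b = 2 * a := by ring
  have h₃ : -b + a = a - b := by ring
  rw [h₁, h₂, h₃, mul_neg, Real.cosh_neg, Real.cosh_neg, mul_sub]
  congr 2 <;> ring

theorem Sfun_gmul_ginv (d : ℕ) (x y : ℝ × (Fin (2 * d) → ℝ) × ℝ) :
    Sfun d (gmul d (ginv d y) x) (ginv d y) = -Sfun d x y := by
  obtain ⟨a, v, t⟩ := x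
  obtain ⟨b, w, s⟩ := y
  simp only [Sfun, gmul, ginv, omega0_add_smul_smul, omega0_smul_left, omega0_swap d v w]
  generalize omega0 d v w = r
  have two (z : ℝ) : Real.exp (2 * z) = Real.exp z ^ 2 := by
    rw [two_mul, Real.exp_add, sq]
  simp only [Real.sinh_eq, Real.cosh_eq, neg_mul, mul_neg, mul_add, neg_add, neg_neg,
    Real.exp_add, Real.exp_neg, two]
  field_simp
  ring

/-- For every real `θ ≠ 0` and all `x, y ∈ G`, the complex conjugate of
`K_θ(y⁻¹·x, y⁻¹)` equals `K_θ(x, y)`. -/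
theorem stmt_5 (d : ℕ) (θ : ℝ) (hθ : θ ≠ 0) (x y : ℝ × (Fin (2 * d) → ℝ) × ℝ) :
    (starRingEnd ℂ) (Kker d θ (gmul d (ginv d y) x) (ginv d y)) = Kker d θ x y := by
  simp only [Kker, Afun_gmul_ginv, Sfun_gmul_ginv, map_mul, Complex.conj_ofReal,
    ← Complex.exp_conj, map_div₀, Complex.conj_I, map_ofNat, map_neg, Complex.ofReal_neg]
  congr 2
  ring
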